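/- arXiv:0808.1585 — 2 statements merged into one kernel-verified Lean document; each statement's English description precedes it below -/
import Mathlib

section
/- Let R be an associative ring with unit and let (A, B) be a hereditary complete cotorsion pair in Mod R with pd_A(A) < ∞. Set β := resdim_A(P^{<∞}), the A-resolution dimension of the class P^{<∞} of modules of finite projective dimension admitting a projective resolution by finitely generated projectives. Then β ≤ findim(R) ≤ pd_A(A) + β, where findim(R) denotes the little finitistic dimension of R. -/
noncomputable section

open CategoryTheory CategoryTheory.Limits Opposite DirectSum

universe u

namespace CotorsionDim

variable {R : Type u} [Ring R]

/-- `Ext^n_R(M,N) = 0`. -/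
def ExtZero (M N : ModuleCat.{u} R) (n : ℕ) : Prop :=
  IsZero (((Ext ℤ (ModuleCat.{u} R) n).obj (op M)).obj N)

/-- A pair of composable maps forms a short exact sequence `0 → A → B → C → 0`. -/
def IsSES {A B C : ModuleCat.{u} R} (f : A ⟶ B) (g : B ⟶ C) : Prop :=
  ∃ w : f ≫ g = 0, (CategoryTheory.ShortComplex.mk f g w).ShortExact

/-- relative projective dimension `pd_𝒳(M)` -/
def rpd (𝒳 : Set (ModuleCat.{u} R)) (M : ModuleCat.{u} R) : ℕ∞ :=
  sInf {n : ℕ∞ | ∀ j : ℕ, n < (j : ℕ∞) → ∀ X ∈ 𝒳, ExtZero M X j}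

/-- relative injective dimension `id_𝒳(M)` -/
def rid (𝒳 : Set (ModuleCat.{u} R)) (M : ModuleCat.{u} R) : ℕ∞ :=
  sInf {n : ℕ∞ | ∀ j : ℕ, n < (j : ℕ∞) → ∀ X ∈ 𝒳, ExtZero X M j}

/-- `pd_𝒳(𝒴)` -/
def rpdClass (𝒳 𝒴 : Set (ModuleCat.{u} R)) : ℕ∞ := ⨆ Y : 𝒴, rpd 𝒳 Y

/-- `id_𝒳(𝒴)` -/
def ridClass (𝒳 𝒴 : Set (ModuleCat.{u} R)) : ℕ∞ := ⨆ Y : 𝒴, rid 𝒳 Y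

/-- projective dimension -/
def pd (M : ModuleCat.{u} R) : ℕ∞ := rpd Set.univ M

/-- injective dimension -/
def idim (M : ModuleCat.{u} R) : ℕ∞ := rid Set.univ M

/-- `pd(𝒴)` -/
def pdClass (𝒴 : Set (ModuleCat.{u} R)) : ℕ∞ := ⨆ Y : 𝒴, pd Y.1

/-- `id(𝒴)` -/
def idClass (𝒴 : Set (ModuleCat.{u} R)) : ℕ∞ := ⨆ Y : 𝒴, idim Y.1

/-- `M` has an `𝒳`-resolution `0 → X_n → ⋯ → X_0 → M → 0` of length `n`. -/
def HasResLen (𝒳 : Set (ModuleCat.{u} R)) : ℕ → ModuleCat.{u} R → Prop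
  | 0, M => M ∈ 𝒳
  | n+1, M => ∃ (K X : ModuleCat.{u} R) (f : K ⟶ X) (g : X ⟶ M),
      X ∈ 𝒳 ∧ IsSES f g ∧ HasResLen 𝒳 n K

/-- `M` has an `𝒳`-coresolution `0 → M → X_0 → ⋯ → X_n → 0` of length `n`. -/
def HasCoresLen (𝒳 : Set (ModuleCat.{u} R)) : ℕ → ModuleCat.{u} R → Prop
  | 0, M => M ∈ 𝒳
  | n+1, M => ∃ (X C : ModuleCat.{u} R) (f : M ⟶ X) (g : X ⟶ C),
      X ∈ 𝒳 ∧ IsSES f g ∧ HasCoresLen 𝒳 n C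

/-- `resdim_𝒳(M)` -/
def resdim (𝒳 : Set (ModuleCat.{u} R)) (M : ModuleCat.{u} R) : ℕ∞ :=
  ⨅ n : {n : ℕ // HasResLen 𝒳 n M}, (n : ℕ∞)

/-- `coresdim_𝒳(M)` -/
def coresdim (𝒳 : Set (ModuleCat.{u} R)) (M : ModuleCat.{u} R) : ℕ∞ :=
  ⨅ n : {n : ℕ // HasCoresLen 𝒳 n M}, (n : ℕ∞)

/-- `resdim_𝒳(𝒴)` -/
def resdimClass (𝒳 𝒴 : Set (ModuleCat.{u} R)) : ℕ∞ := ⨆ Y : 𝒴, resdim 𝒳 Y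

/-- `coresdim_𝒳(𝒴)` -/
def coresdimClass (𝒳 𝒴 : Set (ModuleCat.{u} R)) : ℕ∞ := ⨆ Y : 𝒴, coresdim 𝒳 Y

/-- `𝒳^∧`, the class of modules with a finite `𝒳`-resolution. -/
def resClosure (𝒳 : Set (ModuleCat.{u} R)) : Set (ModuleCat.{u} R) :=
  {M | ∃ n, HasResLen 𝒳 n M}

/-- `𝒳^∨`, the class of modules with a finite `𝒳`-coresolution. -/
def coresClosure (𝒳 : Set (ModuleCat.{u} R)) : Set (ModuleCat.{u} R) :=
  {M | ∃ n, HasCoresLen 𝒳 n M}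

/-- `(𝒜, ℬ)` is a cotorsion pair. -/
def IsCotorsionPair (𝒜 ℬ : Set (ModuleCat.{u} R)) : Prop :=
  (∀ M, M ∈ 𝒜 ↔ ∀ B ∈ ℬ, ExtZero M B 1) ∧
  (∀ M, M ∈ ℬ ↔ ∀ A ∈ 𝒜, ExtZero A M 1)

/-- completeness of a cotorsion pair -/
def IsComplete (𝒜 ℬ : Set (ModuleCat.{u} R)) : Prop :=
  ∀ M : ModuleCat.{u} R,
    (∃ (B A : ModuleCat.{u} R) (f : B ⟶ A) (g : A ⟶ M), B ∈ ℬ ∧ A ∈ 𝒜 ∧ IsSES f g) ∧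
    (∃ (B A : ModuleCat.{u} R) (f : M ⟶ B) (g : B ⟶ A), B ∈ ℬ ∧ A ∈ 𝒜 ∧ IsSES f g)

/-- heredity of a cotorsion pair -/
def IsHereditary (𝒜 ℬ : Set (ModuleCat.{u} R)) : Prop :=
  ∀ i : ℕ, 1 ≤ i → ∀ A ∈ 𝒜, ∀ B ∈ ℬ, ExtZero A B i

variable (R)

/-- `𝒫`, the class of modules of finite projective dimension. -/
def P : Set (ModuleCat.{u} R) := {M | pd M < ⊤}

variable {R}

/-- `M` admits a projective resolution consisting of finitely generated projectives,
i.e. `M ∈ mod R`. -/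
def InmodR (M : ModuleCat.{u} R) : Prop :=
  ∃ K : ℕ → ModuleCat.{u} R, K 0 = M ∧ ∀ i : ℕ,
    ∃ (Q : ModuleCat.{u} R) (f : K (i+1) ⟶ Q) (g : Q ⟶ K i),
      Module.Finite R Q ∧ Projective Q ∧ IsSES f g

variable (R)

/-- `𝒫^{<∞} = 𝒫 ∩ mod R`. -/
def Pfin : Set (ModuleCat.{u} R) := {M | pd M < ⊤ ∧ InmodR M}

/-- the big finitistic dimension -/
def bigFindim : ℕ∞ := pdClass (P R)

/-- the little finitistic dimension -/
def littleFindim : ℕ∞ := pdClass (Pfin R)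

variable {R}

/-- `𝒳^{⊥₁}` -/
def rperp1 (𝒳 : Set (ModuleCat.{u} R)) : Set (ModuleCat.{u} R) :=
  {M | ∀ X ∈ 𝒳, ExtZero X M 1}

/-- `^{⊥₁}𝒳` -/
def lperp1 (𝒳 : Set (ModuleCat.{u} R)) : Set (ModuleCat.{u} R) :=
  {M | ∀ X ∈ 𝒳, ExtZero M X 1}

/-- `T^⊥ = {M : Ext^i(T,M) = 0 for all i > 0}` -/
def rperpAll (T : ModuleCat.{u} R) : Set (ModuleCat.{u} R) :=
  {M | ∀ i : ℕ, 0 < i → ExtZero T M i}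

/-- `Add T`: direct summands of arbitrary direct sums of copies of `T`. -/
def AddT (T : ModuleCat.{u} R) : Set (ModuleCat.{u} R) :=
  {M | ∃ (I : Type u) (s : M ⟶ ModuleCat.of R (I →₀ T)) (r : ModuleCat.of R (I →₀ T) ⟶ M),
    s ≫ r = 𝟙 M}

/-- `T` is a tilting module. -/
def IsTilting (T : ModuleCat.{u} R) : Prop :=
  pd T < ⊤ ∧
  (∀ i : ℕ, 0 < i → ∀ I : Type u, ExtZero T (ModuleCat.of R (I →₀ T)) i) ∧
  ∃ n, HasCoresLen (AddT T) n (ModuleCat.of R R)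


/-- `𝒳` is closed under arbitrary direct sums (coproducts). -/
def ClosedUnderCoproducts (𝒳 : Set (ModuleCat.{u} R)) : Prop :=
  ∀ (I : Type u) (f : I → ModuleCat.{u} R), (∀ i, f i ∈ 𝒳) →
    ModuleCat.of R (⨁ i, (f i : Type u)) ∈ 𝒳

/-- `𝒳` is closed under direct summands. -/
def ClosedUnderSummands (𝒳 : Set (ModuleCat.{u} R)) : Prop :=
  ∀ (M N : ModuleCat.{u} R) (s : M ⟶ N) (r : N ⟶ M), s ≫ r = 𝟙 M → N ∈ 𝒳 → M ∈ 𝒳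

/-- `Ext^{n+1}` computed by a projective resolution vanishes exactly when the group of
Yoneda extensions in the derived category does. -/
lemma extZero_succ_iff (M N : ModuleCat.{u} R) (n : ℕ) :
    ExtZero M N (n + 1) ↔ Subsingleton (Abelian.Ext.{u} M N (n + 1)) := by
  let Q := projectiveResolution M
  have h₁ : ExtZero M N (n + 1) ↔ ∀ f : Q.complex.X (n + 1) ⟶ N,
      Q.complex.d (n + 2) (n + 1) ≫ f = 0 → ∃ g, Q.complex.d (n + 1) n ≫ g = f := by
    unfold ExtZero
    rw [(Q.isoExt (R := ℤ) (n + 1) N).isZero_iff,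
      ← HomologicalComplex.exactAt_iff_isZero_homology,
      HomologicalComplex.exactAt_iff' _ n (n + 1) (n + 2) (by simp) (by simp),
      ShortComplex.moduleCat_exact_iff]
    rfl
  rw [h₁]
  constructor
  · refine fun h ↦ subsingleton_of_forall_eq 0 fun x ↦ ?_
    obtain ⟨f, hf, rfl⟩ := Q.extMk_surjective x (n + 2) rfl
    exact (Q.extMk_eq_zero_iff f (n + 2) rfl hf n rfl).2 (h f hf)
  · intro _ f hf
    exact (Q.extMk_eq_zero_iff f (n + 2) rfl hf n rfl).1 (Subsingleton.elim _ _)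

lemma IsSES.extZero_left {K P M : ModuleCat.{u} R} {f : K ⟶ P} {g : P ⟶ M} (h : IsSES f g)
    {N : ModuleCat.{u} R} {n : ℕ} (hP : ExtZero P N (n + 1)) (hM : ExtZero M N (n + 2)) :
    ExtZero K N (n + 1) := by
  obtain ⟨w, h⟩ := h
  rw [extZero_succ_iff] at *
  refine subsingleton_of_forall_eq 0 fun x ↦ ?_
  obtain ⟨y, rfl⟩ := Abelian.Ext.contravariant_sequence_exact₁ h _ x (n₁ := n + 2) (by lia)
    (Subsingleton.elim _ _)
  rw [Subsingleton.elim y 0, Abelian.Ext.comp_zero]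

lemma IsSES.extZero_right {K P M : ModuleCat.{u} R} {f : K ⟶ P} {g : P ⟶ M} (h : IsSES f g)
    {N : ModuleCat.{u} R} {n : ℕ} (hK : ExtZero K N (n + 1)) (hP : ExtZero P N (n + 2)) :
    ExtZero M N (n + 2) := by
  obtain ⟨w, h⟩ := h
  rw [extZero_succ_iff] at *
  refine subsingleton_of_forall_eq 0 fun x ↦ ?_
  obtain ⟨y, rfl⟩ := Abelian.Ext.contravariant_sequence_exact₃ h _ x
    (Subsingleton.elim (α := Abelian.Ext P N (n + 1 + 1)) _ _) (n₀ := n + 1) (by lia)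
  rw [Subsingleton.elim y 0, Abelian.Ext.comp_zero]

lemma IsSES.extZero_covariant {B A X : ModuleCat.{u} R} {f : B ⟶ A} {g : A ⟶ X} (h : IsSES f g)
    {M : ModuleCat.{u} R} {n : ℕ} (hA : ExtZero M A (n + 1)) (hB : ExtZero M B (n + 2)) :
    ExtZero M X (n + 1) := by
  obtain ⟨w, h⟩ := h
  rw [extZero_succ_iff] at *
  refine subsingleton_of_forall_eq 0 fun x ↦ ?_
  obtain ⟨y, rfl⟩ := Abelian.Ext.covariant_sequence_exact₃ _ h x (n₁ := n + 2) (by lia)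
    (Subsingleton.elim _ _)
  rw [Subsingleton.elim y 0, Abelian.Ext.zero_comp]

lemma rpd_le_iff {𝒳 : Set (ModuleCat.{u} R)} {M : ModuleCat.{u} R} {n : ℕ∞} :
    rpd 𝒳 M ≤ n ↔ ∀ j : ℕ, n < j → ∀ X ∈ 𝒳, ExtZero M X j := by
  refine ⟨fun h j hj ↦ ?_, fun h ↦ sInf_le h⟩
  have hmem : rpd 𝒳 M ∈ {n : ℕ∞ | ∀ j : ℕ, n < (j : ℕ∞) → ∀ X ∈ 𝒳, ExtZero M X j} :=
    csInf_mem ⟨⊤, fun j hj ↦ (not_top_lt hj).elim⟩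
  exact hmem j (h.trans_lt hj)

lemma resdim_le_of_hasResLen {𝒳 : Set (ModuleCat.{u} R)} {M : ModuleCat.{u} R} {n : ℕ}
    (h : HasResLen 𝒳 n M) : resdim 𝒳 M ≤ n :=
  iInf_le (fun n : {n : ℕ // HasResLen 𝒳 n M} ↦ ((n : ℕ) : ℕ∞)) ⟨n, h⟩

lemma exists_hasResLen_of_resdim_ne_top {𝒳 : Set (ModuleCat.{u} R)} {M : ModuleCat.{u} R}
    (h : resdim 𝒳 M ≠ ⊤) : ∃ n : ℕ, HasResLen 𝒳 n M ∧ resdim 𝒳 M = n := by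
  rcases isEmpty_or_nonempty {n : ℕ // HasResLen 𝒳 n M} with _ | _
  · exact (h (iInf_of_empty _)).elim
  · obtain ⟨n, hn⟩ := ciInf_mem (fun n : {n : ℕ // HasResLen 𝒳 n M} ↦ ((n : ℕ) : ℕ∞))
    exact ⟨n, n.2, hn.symm⟩

lemma hasResLen_of_extZero {𝒜 ℬ : Set (ModuleCat.{u} R)} (hcp : IsCotorsionPair 𝒜 ℬ) (n : ℕ)
    (M : ModuleCat.{u} R) (h : ∀ j, n < j → ∀ X, ExtZero M X j) : HasResLen 𝒜 n M := by
  induction n generalizing M with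
  | zero => exact (hcp.1 M).2 fun B _ ↦ h 1 one_pos B
  | succ n ih =>
    have hses : IsSES (kernel.ι (Projective.π M)) (Projective.π M) :=
      ⟨kernel.condition _, { exact := ShortComplex.exact_kernel _ }⟩
    refine ⟨_, _, _, _, (hcp.1 _).2 fun B _ ↦ isZero_Ext_succ_of_projective _ B 0, hses,
      ih _ fun j hj X ↦ ?_⟩
    obtain ⟨j, rfl⟩ := Nat.exists_eq_add_one_of_ne_zero (Nat.ne_zero_of_lt hj)
    exact hses.extZero_left (isZero_Ext_succ_of_projective _ X j) (h (j + 2) (by lia) X)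

lemma extZero_of_hasResLen {𝒜 : Set (ModuleCat.{u} R)} {Y : ModuleCat.{u} R} {p : ℕ}
    (hY : ∀ A ∈ 𝒜, ∀ j, p < j → ExtZero A Y j) (n : ℕ) (M : ModuleCat.{u} R)
    (h : HasResLen 𝒜 n M) (j : ℕ) (hj : p + n < j) : ExtZero M Y j := by
  induction n generalizing M j with
  | zero => exact hY M h j hj
  | succ n ih =>
    obtain ⟨K, A, f, g, hA, hses, hK⟩ := h
    obtain ⟨j, rfl⟩ : ∃ i, j = i + 2 := ⟨j - 2, by lia⟩
    exact hses.extZero_right (ih K hK (j + 1) (by lia)) (hY A hA (j + 2) (by lia))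

lemma resdim_le_pd {𝒜 ℬ : Set (ModuleCat.{u} R)} (hcp : IsCotorsionPair 𝒜 ℬ)
    (M : ModuleCat.{u} R) : resdim 𝒜 M ≤ pd M := by
  rcases eq_or_ne (pd M) ⊤ with h | h
  · exact h ▸ le_top
  · obtain ⟨n, hn⟩ := ENat.ne_top_iff_exists.1 h
    rw [← hn]
    exact resdim_le_of_hasResLen (hasResLen_of_extZero hcp n M fun j hj X ↦
      rpd_le_iff.1 hn.ge j (by exact_mod_cast hj) X (Set.mem_univ X))

lemma pd_le_rpdClass_add_resdim {𝒜 ℬ : Set (ModuleCat.{u} R)} (hcomp : IsComplete 𝒜 ℬ)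
    (hher : IsHereditary 𝒜 ℬ) (M : ModuleCat.{u} R) :
    pd M ≤ rpdClass 𝒜 𝒜 + resdim 𝒜 M := by
  rcases eq_or_ne (rpdClass 𝒜 𝒜) ⊤ with hp | hp
  · simp [hp]
  rcases eq_or_ne (resdim 𝒜 M) ⊤ with hr | hr
  · simp [hr]
  obtain ⟨p, hp⟩ := ENat.ne_top_iff_exists.1 hp
  obtain ⟨n, hn, hr⟩ := exists_hasResLen_of_resdim_ne_top hr
  rw [← hp, hr]
  refine rpd_le_iff.2 fun j hj X _ ↦ ?_
  replace hj : p + n < j := by exact_mod_cast hj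
  obtain ⟨j, rfl⟩ := Nat.exists_eq_add_one_of_ne_zero (Nat.ne_zero_of_lt hj)
  obtain ⟨B, A, f, g, hB, hA, hses⟩ := (hcomp X).1
  refine hses.extZero_covariant
    (extZero_of_hasResLen (p := p) (fun A' hA' i hi ↦ ?_) n M hn _ hj)
    (extZero_of_hasResLen (p := 0) (fun A' hA' i hi ↦ hher i hi A' hA' B hB) n M hn _ (by lia))
  have hle : rpd 𝒜 A' ≤ p := hp ▸ le_iSup (fun Y : 𝒜 ↦ rpd 𝒜 Y) ⟨A', hA'⟩
  exact rpd_le_iff.1 hle i (by exact_mod_cast hi) A hA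

/-- Theorem 4.2(b): `β ≤ findim(R) ≤ pd_𝒜(𝒜) + β` where `β = resdim_𝒜(𝒫^{<∞})`. -/
theorem stmt1 {R : Type u} [Ring R] (𝒜 ℬ : Set (ModuleCat.{u} R))
    (hcp : IsCotorsionPair 𝒜 ℬ) (hcomp : IsComplete 𝒜 ℬ) (hher : IsHereditary 𝒜 ℬ)
    (hpd : rpdClass 𝒜 𝒜 < ⊤) :
    resdimClass 𝒜 (Pfin R) ≤ littleFindim R ∧
      littleFindim R ≤ rpdClass 𝒜 𝒜 + resdimClass 𝒜 (Pfin R) := by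
  refine ⟨iSup_le fun M ↦ (resdim_le_pd hcp M).trans (le_iSup (fun M : Pfin R ↦ pd M.1) M),
    iSup_le fun M ↦ (pd_le_rpdClass_add_resdim hcomp hher M).trans ?_⟩
  gcongr
  exact le_iSup (fun M : Pfin R ↦ resdim 𝒜 M) M

end CotorsionDim
end
end

section
/- Let R be a right noetherian ring with findim(R) < ∞, and let (A, B) be the cotorsion pair generated by P^{<∞}, i.e. B = (P^{<∞})^{⊥1} and A = ^{⊥1}B. Then Findim(R) − findim(R) ≤ resdim_A(P). -/
noncomputable section

open CategoryTheory CategoryTheory.Limits Opposite DirectSum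

universe u

namespace CotorsionDim

variable {R : Type u} [Ring R]

variable (R)

variable {R}

variable (R)

variable {R}

/-- Vanishing of `Ext^{n+1}(M,N)` in terms of cocycles and coboundaries of a projective resolution
of `M`. -/
lemma extZero_succ_iff_s4 {M : ModuleCat.{u} R} (Q : ProjectiveResolution M) (N : ModuleCat.{u} R)
    (n : ℕ) :
    ExtZero M N (n + 1) ↔ ∀ f : Q.complex.X (n + 1) ⟶ N, Q.complex.d (n + 2) (n + 1) ≫ f = 0 →
      ∃ g : Q.complex.X n ⟶ N, Q.complex.d (n + 1) n ≫ g = f := by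
  rw [ExtZero, (Q.isoExt (R := ℤ) (n + 1) N).isZero_iff,
    ← HomologicalComplex.exactAt_iff_isZero_homology,
    HomologicalComplex.exactAt_iff' _ n (n + 1) (n + 2) (by simp) (by simp),
    ShortComplex.moduleCat_exact_iff]
  rfl

lemma extZero_succ_iff_subsingleton (M N : ModuleCat.{u} R) (n : ℕ) :
    ExtZero M N (n + 1) ↔ Subsingleton (Abelian.Ext M N (n + 1)) := by
  let Q : ProjectiveResolution M := projectiveResolution M
  rw [extZero_succ_iff_s4 Q]
  constructor
  · intro h
    refine subsingleton_of_forall_eq 0 fun α => ?_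
    obtain ⟨f, hf, rfl⟩ := Q.extMk_surjective α (n + 2) rfl
    exact (Q.extMk_eq_zero_iff f _ rfl hf n rfl).2 (h f hf)
  · intro h f hf
    exact (Q.extMk_eq_zero_iff f _ rfl hf n rfl).1 (Subsingleton.elim _ _)

lemma pd_le_iff (M : ModuleCat.{u} R) (n : ℕ) :
    pd M ≤ n ↔ HasProjectiveDimensionLT M (n + 1) := by
  rw [hasProjectiveDimensionLT_iff]
  constructor
  · intro h i hi N e
    have hmem : pd M ∈ {n : ℕ∞ | ∀ j : ℕ, n < (j : ℕ∞) → ∀ X ∈ Set.univ, ExtZero M X j} :=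
      csInf_mem ⟨⊤, fun j hj => absurd hj (by simp)⟩
    obtain ⟨k, rfl⟩ : ∃ k, i = k + 1 := ⟨i - 1, by lia⟩
    have := hmem (k + 1) (h.trans_lt (by exact_mod_cast hi)) N trivial
    rw [extZero_succ_iff_subsingleton] at this
    exact Subsingleton.elim _ _
  · intro h
    refine sInf_le fun j hj N _ => ?_
    have hj : n + 1 ≤ j := by exact_mod_cast hj
    obtain ⟨k, rfl⟩ : ∃ k, j = k + 1 := ⟨j - 1, by lia⟩
    rw [extZero_succ_iff_subsingleton]
    exact subsingleton_of_forall_eq 0 fun e => h _ hj e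

/-- Dimension shifting along an injective coresolution: `N'` is a `d`-th cosyzygy of `N`. -/
lemma exists_cosyzygy (N : ModuleCat.{u} R) (d : ℕ) :
    ∃ N' : ModuleCat.{u} R, ∀ (X : ModuleCat.{u} R) (k : ℕ),
      Subsingleton (Abelian.Ext X N' (k + 1)) ↔ Subsingleton (Abelian.Ext X N (k + 1 + d)) := by
  induction d with
  | zero => exact ⟨N, fun X k => Iff.rfl⟩
  | succ d ih =>
    obtain ⟨L, hL⟩ := ih
    let S := ShortComplex.mk (Injective.ι L) _ (cokernel.condition (Injective.ι L))
    have hS : S.ShortExact := { exact := ShortComplex.exact_cokernel (Injective.ι L) }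
    have : Injective S.X₂ := inferInstanceAs (Injective (Injective.under L))
    refine ⟨S.X₃, fun X k => ?_⟩
    rw [show k + 1 + (d + 1) = k + 1 + 1 + d by lia, ← hL X (k + 1)]
    constructor
    · intro h
      refine subsingleton_of_forall_eq 0 fun e => ?_
      obtain ⟨y, rfl⟩ := Abelian.Ext.covariant_sequence_exact₁ X hS e
        (Abelian.Ext.eq_zero_of_injective _) rfl
      rw [Subsingleton.elim y 0, Abelian.Ext.zero_comp]
    · intro h
      refine subsingleton_of_forall_eq 0 fun e => ?_
      obtain ⟨y, rfl⟩ := Abelian.Ext.covariant_sequence_exact₃ X hS e rfl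
        (h.elim _ _)
      rw [Abelian.Ext.eq_zero_of_injective y, Abelian.Ext.zero_comp]

/-- A bound on the projective dimension of a class passes to the left half of the cotorsion pair it
generates. -/
lemma pd_le_of_mem_lperp1_rperp1 {𝒳 : Set (ModuleCat.{u} R)} {d : ℕ}
    (h𝒳 : ∀ X ∈ 𝒳, pd X ≤ d) {A : ModuleCat.{u} R} (hA : A ∈ lperp1 (rperp1 𝒳)) :
    pd A ≤ d := by
  rw [pd_le_iff]
  refine hasProjectiveDimensionLT_of_enoughInjectives A (d + 1) fun N => ?_
  obtain ⟨N', hN'⟩ := exists_cosyzygy N d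
  have hmem : N' ∈ rperp1 𝒳 := fun X hX => by
    have := (pd_le_iff X d).1 (h𝒳 X hX)
    rw [extZero_succ_iff_subsingleton X N' 0, hN']
    exact HasProjectiveDimensionLT.subsingleton X (d + 1) _ (by lia) N
  rw [show d + 1 = 0 + 1 + d by lia]
  exact (hN' A 0).1 ((extZero_succ_iff_subsingleton A N' 0).1 (hA N' hmem))

lemma pd_le_of_hasResLen {𝒳 : Set (ModuleCat.{u} R)} {d : ℕ} (h𝒳 : ∀ X ∈ 𝒳, pd X ≤ d)
    {n : ℕ} {M : ModuleCat.{u} R} (hM : HasResLen 𝒳 n M) : pd M ≤ (n + d : ℕ) := by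
  induction n generalizing M with
  | zero => simpa using h𝒳 M hM
  | succ n ih =>
    obtain ⟨K, X, f, g, hX, ⟨w, hS⟩, hK⟩ := hM
    have hK := (pd_le_iff K _).1 (ih hK)
    have hX := (pd_le_iff X _).1 ((h𝒳 X hX).trans
      (by exact_mod_cast (show d ≤ n + 1 + d by lia)))
    rw [show n + d + 1 = n + 1 + d by lia] at hK
    exact (pd_le_iff M _).2 (hS.hasProjectiveDimensionLT_X₃ _ hK hX)

/-- Theorem 4.4(a): `Findim(R) − findim(R) ≤ resdim_𝒜(𝒫)` for the cotorsion pair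
generated by `𝒫^{<∞}` over a right noetherian ring with `findim R < ∞`. -/
theorem stmt4 {R : Type u} [Ring R] [IsNoetherianRing R]
    (hfd : littleFindim R < ⊤) (𝒜 ℬ : Set (ModuleCat.{u} R))
    (hB : ℬ = rperp1 (Pfin R)) (hA : 𝒜 = lperp1 ℬ) :
    bigFindim R - littleFindim R ≤ resdimClass 𝒜 (P R) := by
  subst hB hA
  obtain ⟨d, hd⟩ := ENat.ne_top_iff_exists.1 hfd.ne
  have hPfin : ∀ X ∈ Pfin R, pd X ≤ d := fun X hX =>
    hd ▸ le_iSup (fun Y : Pfin R => pd Y.1) ⟨X, hX⟩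
  rw [tsub_le_iff_right, ← hd]
  refine iSup_le fun M => ?_
  calc pd M.1 ≤ resdim (lperp1 (rperp1 (Pfin R))) M.1 + d := by
        rw [resdim, ENat.iInf_add]
        refine le_iInf fun n => ?_
        exact_mod_cast pd_le_of_hasResLen
          (fun X hX => pd_le_of_mem_lperp1_rperp1 hPfin hX) n.2
    _ ≤ resdimClass (lperp1 (rperp1 (Pfin R))) (P R) + d := by
        gcongr
        exact le_iSup (fun Y : P R => resdim (lperp1 (rperp1 (Pfin R))) Y.1) M

end CotorsionDim
end
end
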